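/- arXiv:1006.0152 — 3 statements merged into one kernel-verified Lean document; each statement's English description precedes it below -/
import Mathlib

section
/- Let A be an n×n real matrix and suppose there exist m ≥ 1 and an injective map v : Z/mZ → {1,...,n} such that A_{rs} ≠ 0 exactly when (r,s) = (v(t), v(t+1)) for some t ∈ Z/mZ, and such that (-1)^m · ∏_{t∈Z/mZ} A_{v(t),v(t+1)} > 0. Then A is not a P0-matrix; indeed the principal minor of A indexed by the image of v is negative. -/
/-- `M` is a P0-matrix: every principal minor is nonnegative. -/
def IsP0Matrix {n : ℕ} (M : Matrix (Fin n) (Fin n) ℝ) : Prop :=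
  ∀ α : Finset (Fin n),
    0 ≤ (M.submatrix (fun i : {x // x ∈ α} => (i : Fin n))
          (fun i : {x // x ∈ α} => (i : Fin n))).det

/-- The signed digraph `G_A` of the square matrix `A` contains an e-cycle:
a cycle through distinct vertices `v 0, v 1, …` of some length `m + 1 ≥ 1`, all of whose
edges correspond to nonzero entries of `A`, such that `(-1)^(m+1)` times the product of
the corresponding entries is positive. -/
def HasECycleSq {n : ℕ} (A : Matrix (Fin n) (Fin n) ℝ) : Prop :=
  ∃ (m : ℕ) (v : ZMod (m + 1) → Fin n),
    Function.Injective v ∧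
    (∀ t : ZMod (m + 1), A (v t) (v (t + 1)) ≠ 0) ∧
    0 < (-1 : ℝ) ^ (m + 1) * ∏ t : ZMod (m + 1), A (v t) (v (t + 1))

/-- `X` lies in the qualitative class of `M`. -/
def InQualClass {p q : ℕ} (X M : Matrix (Fin p) (Fin q) ℝ) : Prop :=
  ∀ i j, (0 < M i j → 0 < X i j) ∧ (M i j < 0 → X i j < 0) ∧ (M i j = 0 → X i j = 0)

/-- Translation by one on `ZMod (m + 1)` is a cycle of length `m + 1`. -/
theorem sign_addRight_one (m : ℕ) :
    Equiv.Perm.sign (Equiv.addRight (1 : ZMod (m + 1))) = (-1) ^ m := by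
  have h : Equiv.addRight (1 : ZMod (m + 1)) = finRotate (m + 1) := by
    ext1 t
    exact (finRotate_apply t).symm
  rw [show (-1 : ℤˣ) ^ m = (-1) ^ (m + 1 - 1) from rfl, ← sign_finRotate (m + 1), ← h]
  congr!

/-- The determinant of a matrix supported on the graph of a permutation. -/
theorem det_of_support_perm {ι : Type*} [Fintype ι] [DecidableEq ι]
    (B : Matrix ι ι ℝ) (σ : Equiv.Perm ι) (hB : ∀ i j, j ≠ σ i → B i j = 0) :
    B.det = Equiv.Perm.sign σ * ∏ i, B i (σ i) := by
  have h : B = (Matrix.diagonal fun i => B i (σ i)).submatrix id (σ⁻¹ : Equiv.Perm ι) := by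
    ext i j
    by_cases hj : j = σ i
    · subst hj
      simp
    · have hij : i ≠ σ⁻¹ j := fun h => hj (by simp [h])
      simp only [Matrix.submatrix_apply, id, Matrix.diagonal_apply_ne _ hij, hB i j hj]
  conv_lhs => rw [h]
  rw [Matrix.det_permute', Matrix.det_diagonal, Equiv.Perm.sign_inv]

theorem stmt5 {n : ℕ} (A : Matrix (Fin n) (Fin n) ℝ) (m : ℕ)
    (v : ZMod (m + 1) → Fin n) (hinj : Function.Injective v)
    (hexact : ∀ r s : Fin n, A r s ≠ 0 ↔ ∃ t : ZMod (m + 1), r = v t ∧ s = v (t + 1))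
    (hsign : 0 < (-1 : ℝ) ^ (m + 1) * ∏ t : ZMod (m + 1), A (v t) (v (t + 1))) :
    (A.submatrix (fun i : {x // x ∈ Finset.image v Finset.univ} => (i : Fin n))
        (fun i : {x // x ∈ Finset.image v Finset.univ} => (i : Fin n))).det < 0 ∧
      ¬ IsP0Matrix A := by
  have hdet : (A.submatrix v v).det < 0 := by
    rw [det_of_support_perm (A.submatrix v v) (Equiv.addRight 1), sign_addRight_one]
    · simp only [Matrix.submatrix_apply, Equiv.coe_addRight]
      push_cast
      rw [pow_succ] at hsign
      linarith
    · intro i j hij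
      by_contra h
      obtain ⟨t, hi, hj⟩ := (hexact (v i) (v j)).1 h
      exact hij (by rw [hinj hi, hinj hj]; rfl)
  let e : ZMod (m + 1) ≃ {x // x ∈ Finset.image v Finset.univ} :=
    Equiv.ofBijective (fun t => ⟨v t, Finset.mem_image_of_mem v (Finset.mem_univ t)⟩)
      ⟨fun a b h => hinj (congrArg Subtype.val h), fun ⟨x, hx⟩ => by
        obtain ⟨t, -, rfl⟩ := Finset.mem_image.1 hx
        exact ⟨t, rfl⟩⟩
  have hneg : (A.submatrix (fun i : {x // x ∈ Finset.image v Finset.univ} => (i : Fin n))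
      (fun i : {x // x ∈ Finset.image v Finset.univ} => (i : Fin n))).det < 0 := by
    rw [← Matrix.det_submatrix_equiv_self e]
    exact hdet
  exact ⟨hneg, fun hP => (hP _).not_gt hneg⟩
end

section
/- Let k ≥ 1 and let A^{(0)},...,A^{(k-1)} be real matrices with A^{(j)} of size n_j × n_{j+1} (indices mod k). Then every matrix of the form B^{(0)}B^{(1)}···B^{(k-1)} with B^{(j)} ∈ Q(A^{(j)}) for all j is a P0-matrix if and only if the associated signed digraph G_{A^{(0)}···A^{(k-1)}} is e-cycle-free. -/
/-- Product `A^(0) * A^(1) * ⋯ * A^(l-1)`. -/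
def matProd0 (n : ℕ → ℕ) (A : ∀ j : ℕ, Matrix (Fin (n j)) (Fin (n (j + 1))) ℝ) :
    (l : ℕ) → Matrix (Fin (n 0)) (Fin (n l)) ℝ
  | 0 => 1
  | l + 1 => matProd0 n A l * A l

/-- The signed digraph associated with the list `A^(0), …, A^(k-1)` contains an e-cycle. -/
def HasECycle (k : ℕ) (n : ℕ → ℕ) (hn : n k = n 0)
    (A : ∀ j : ℕ, Matrix (Fin (n j)) (Fin (n (j + 1))) ℝ) : Prop :=
  ∃ (m : ℕ) (v : ∀ j : ℕ, ZMod (m + 1) → Fin (n j)),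
    (∀ j < k, Function.Injective (v j)) ∧
    (∀ t : ZMod (m + 1), v k t = Fin.cast hn.symm (v 0 (t + 1))) ∧
    (∀ j < k, ∀ t : ZMod (m + 1), A j (v j t) (v (j + 1) t) ≠ 0) ∧
    0 < (-1 : ℝ) ^ (m + 1) *
        ∏ t : ZMod (m + 1), ∏ j ∈ Finset.range k, A j (v j t) (v (j + 1) t)

open Equiv Finset

/-- The bound `0 ≤ sign σ * ∏ F`, over the support of `σ`, from the bound on each of its cycles. -/
theorem sign_mul_prod_support_nonneg {α : Type*} [Fintype α] [DecidableEq α] (σ : Perm α) :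
    ∀ F : α → ℝ, (∀ (m : ℕ) (u : ZMod (m + 1) → α), Function.Injective u →
      (∀ t, u t ∈ σ.support) → (∀ t, σ (u (t + 1)) = u t) → 0 ≤ (-1) ^ m * ∏ t, F (u t)) →
    0 ≤ ((Perm.sign σ : ℤ) : ℝ) * ∏ x ∈ σ.support, F x := by
  induction σ using Perm.cycle_induction_on with
  | base_one => intro F _; simp
  | base_cycles σ hσ =>
    intro F h
    obtain ⟨x, hx, -⟩ := id hσ
    obtain ⟨m, hm⟩ : ∃ m, orderOf σ⁻¹ = m + 1 :=
      Nat.exists_eq_succ_of_ne_zero (orderOf_pos σ⁻¹).ne'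
    have hcard : #σ.support = m + 1 := by rw [← hσ.orderOf, ← orderOf_inv, hm]
    have hinj : Function.Injective fun t : ZMod (m + 1) => (σ⁻¹ ^ t.val) x := by
      intro s t hst
      have h1 : σ⁻¹ ^ s.val = σ⁻¹ ^ t.val :=
        hσ.inv.pow_eq_pow_iff.2 ⟨x, fun h => hx (Perm.inv_eq_iff_eq.1 h).symm, hst⟩
      exact ZMod.val_injective _ <|
        pow_injOn_Iio_orderOf (by simpa [hm] using s.val_lt) (by simpa [hm] using t.val_lt) h1
    have hmem : ∀ t : ZMod (m + 1), (σ⁻¹ ^ t.val) x ∈ σ.support := fun t => by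
      rw [← Perm.support_inv, Perm.pow_apply_mem_support, Perm.support_inv]
      exact Perm.mem_support.2 hx
    have hstep : ∀ t : ZMod (m + 1), σ ((σ⁻¹ ^ (t + 1).val) x) = (σ⁻¹ ^ t.val) x := fun t => by
      have : σ⁻¹ ^ (t + 1).val = σ⁻¹ ^ (t.val + 1) := by
        rw [pow_eq_pow_iff_modEq, hm, Nat.ModEq, ZMod.val_add, ZMod.val_one_eq_one_mod]
        simp
      rw [this, pow_succ', Perm.mul_apply, ← Perm.mul_apply σ, mul_inv_cancel, Perm.one_apply]
    have himage : univ.image (fun t : ZMod (m + 1) => (σ⁻¹ ^ t.val) x) = σ.support := by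
      refine eq_of_subset_of_card_le (by simpa [image_subset_iff] using hmem) ?_
      rw [card_image_of_injective _ hinj, hcard]
      simp [ZMod.card]
    rw [hσ.sign, hcard, ← himage, prod_image hinj.injOn]
    simpa [pow_succ] using h m _ hinj hmem hstep
  | induction_disjoint σ τ hd _ ihσ ihτ =>
    intro F h
    rw [Perm.sign_mul, hd.support_mul, prod_union hd.disjoint_support]
    have h1 := ihσ F fun m u hu hs ht => h m u hu
      (fun t => by rw [hd.support_mul]; exact mem_union_left _ (hs t)) fun t => by
        have : τ (u (t + 1)) = u (t + 1) :=
          (hd (u (t + 1))).resolve_left (Perm.mem_support.1 (hs _))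
        rw [Perm.mul_apply, this, ht]
    have h2 := ihτ F fun m u hu hs ht => h m u hu
      (fun t => by rw [hd.support_mul]; exact mem_union_right _ (hs t)) fun t => by
        have : σ (u t) = u t := (hd (u t)).resolve_right (Perm.mem_support.1 (hs _))
        rw [Perm.mul_apply, ht, this]
    rw [Units.val_mul, Int.cast_mul, mul_mul_mul_comm]
    exact mul_nonneg h1 h2

theorem sign_mul_prod_nonneg {α : Type*} [Fintype α] [DecidableEq α] (σ : Perm α) (F : α → ℝ)
    (h : ∀ (m : ℕ) (u : ZMod (m + 1) → α), Function.Injective u →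
      (∀ t, σ (u (t + 1)) = u t) → 0 ≤ (-1) ^ m * ∏ t, F (u t)) :
    0 ≤ ((Perm.sign σ : ℤ) : ℝ) * ∏ x, F x := by
  rw [← prod_mul_prod_compl σ.support F, ← mul_assoc]
  refine mul_nonneg (sign_mul_prod_support_nonneg σ F fun m u hu _ ht => h m u hu ht)
    (prod_nonneg fun x hx => ?_)
  have hx : σ x = x := by simpa using hx
  simpa using h 0 (fun _ => x) (Function.injective_of_subsingleton (α := Fin 1) _) fun _ => hx

/-- Expansion of a minor of a product, in the style of the Cauchy–Binet formula. -/
theorem det_mul_submatrix {ι p q r : Type*} [Fintype ι] [DecidableEq ι] [Fintype q]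
    [DecidableEq q] (P : Matrix p q ℝ) (A : Matrix q r ℝ) (f : ι → p) (g : ι → r) :
    ((P * A).submatrix f g).det =
      ∑ w : ι → q, (P.submatrix f w).det * ∏ i, A (w i) (g i) := by
  simp only [Matrix.det_apply', Matrix.submatrix_apply, Matrix.mul_apply, prod_univ_sum,
    Fintype.piFinset_univ, mul_sum, sum_mul, prod_mul_distrib]
  rw [sum_comm]
  simp only [mul_assoc]

theorem sign_prod {ι : Type*} (s : Finset ι) (f : ι → ℝ) :
    SignType.sign (∏ i ∈ s, f i) = ∏ i ∈ s, SignType.sign (f i) :=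
  map_prod signHom f s

theorem InQualClass.sign_eq {p q : ℕ} {X M : Matrix (Fin p) (Fin q) ℝ} (h : InQualClass X M)
    (i : Fin p) (j : Fin q) : SignType.sign (X i j) = SignType.sign (M i j) := by
  obtain ⟨hp, hm, hz⟩ := h i j
  rcases lt_trichotomy (M i j) 0 with h | h | h
  · rw [sign_neg h, sign_neg (hm h)]
  · rw [h, hz h]
  · rw [sign_pos h, sign_pos (hp h)]

theorem HasECycle.of_inQualClass {k : ℕ} {n : ℕ → ℕ} {hn : n k = n 0}
    {A B : ∀ j : ℕ, Matrix (Fin (n j)) (Fin (n (j + 1))) ℝ}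
    (hB : ∀ j < k, InQualClass (B j) (A j)) (h : HasECycle k n hn B) : HasECycle k n hn A := by
  obtain ⟨m, v, hinj, hclose, hne, hpos⟩ := h
  refine ⟨m, v, hinj, hclose, fun j hj t => ?_, ?_⟩
  · rw [← sign_ne_zero, ← (hB j hj).sign_eq, sign_ne_zero]
    exact hne j hj t
  · rw [← sign_eq_one_iff] at hpos ⊢
    rw [← hpos, sign_mul, sign_mul]
    simp only [sign_prod]
    congr 1
    exact prod_congr rfl fun t _ => prod_congr rfl fun j hj =>
      ((hB j (mem_range.1 hj)).sign_eq _ _).symm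

/-- Each partially expanded term of a principal minor of the product is nonnegative. -/
theorem det_mul_prod_nonneg {k : ℕ} (hk : 1 ≤ k) {n : ℕ → ℕ} {hn : n k = n 0}
    {A : ∀ j : ℕ, Matrix (Fin (n j)) (Fin (n (j + 1))) ℝ} (hA : ¬ HasECycle k n hn A)
    (α : Finset (Fin (n 0))) (l : ℕ) (hl : l ≤ k) :
    ∀ w : ∀ j : ℕ, α → Fin (n j), (∀ i, w k i = Fin.cast hn.symm i) →
      (∀ j, l ≤ j → j < k → Function.Injective (w j)) →
      0 ≤ ((matProd0 n A l).submatrix (fun i : α => (i : Fin (n 0))) (w l)).det *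
        ∏ j ∈ Ico l k, ∏ i, A j (w j i) (w (j + 1) i) := by
  induction l with
  | zero =>
    intro w hwk hw
    have hw0 := hw 0 le_rfl hk
    by_cases hmem : ∀ i, w 0 i ∈ α
    · let σ : Perm α := Equiv.ofBijective (fun i => ⟨w 0 i, hmem i⟩) <|
        Finite.injective_iff_bijective.1 fun i j hij => hw0 (congrArg Subtype.val hij)
      have hσ : ∀ i, (σ i : Fin (n 0)) = w 0 i := fun i => rfl
      have hdet : ((matProd0 n A 0).submatrix (fun i : α => (i : Fin (n 0))) (w 0)).det =
          ((Perm.sign σ : ℤ) : ℝ) := by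
        rw [← mul_one ((Perm.sign σ : ℤ) : ℝ), ← Matrix.det_one (n := α), ← Matrix.det_permute']
        congr 1
        ext i j
        rw [Matrix.submatrix_apply, Matrix.submatrix_apply, ← hσ, matProd0, Matrix.one_apply,
          Matrix.one_apply]
        simp only [Subtype.ext_iff, id]
      rw [hdet, prod_comm]
      refine sign_mul_prod_nonneg σ _ fun m u hu ht => ?_
      by_contra! hneg
      refine hA ⟨m, fun j t => w j (u t), fun j hj => (hw j j.zero_le hj).comp hu,
        fun t => ?_, fun j hj t h0 => hneg.ne ?_, ?_⟩
      · change w k (u t) = Fin.cast hn.symm (w 0 (u (t + 1)))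
        rw [hwk, ← hσ, ht]
      · rw [prod_eq_zero (mem_univ t) (prod_eq_zero (mem_Ico.2 ⟨j.zero_le, hj⟩) h0), mul_zero]
      · rw [pow_succ, mul_neg_one, neg_mul, range_eq_Ico]
        exact neg_pos.2 hneg
    · push Not at hmem
      obtain ⟨i, hi⟩ := hmem
      rw [Matrix.det_eq_zero_of_column_eq_zero i, zero_mul]
      intro j
      have : (j : Fin (n 0)) ≠ w 0 i := fun h => hi (h ▸ j.2)
      simp [matProd0, this]
  | succ l ih =>
    intro w hwk hw
    rw [matProd0, det_mul_submatrix, sum_mul]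
    refine sum_nonneg fun f _ => ?_
    by_cases hf : Function.Injective f
    · have hne : ∀ j, l + 1 ≤ j → Function.update w l f j = w j := fun j hj =>
        Function.update_of_ne (by omega) _ _
      have h := ih (by omega) (Function.update w l f) (fun i => by rw [hne k hl, hwk])
        fun j hlj hjk => by
          rcases hlj.eq_or_lt with rfl | hlj
          · simpa using hf
          · rw [hne j hlj]; exact hw j hlj hjk
      rw [prod_eq_prod_Ico_succ_bot (by omega), ← mul_assoc, Function.update_self,
        hne (l + 1) le_rfl] at h
      refine h.trans_eq (congrArg _ (prod_congr rfl fun j hj => ?_))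
      have := (mem_Ico.1 hj).1
      rw [hne j this, hne (j + 1) (by omega)]
    · simp only [Function.Injective, not_forall] at hf
      obtain ⟨a, b, hab, hne⟩ := hf
      rw [Matrix.det_zero_of_column_eq hne (by simp [hab]), zero_mul, zero_mul]

theorem isP0Matrix_of_not_hasECycle {k : ℕ} (hk : 1 ≤ k) {n : ℕ → ℕ} (hpos : ∀ j, 0 < n j)
    {hn : n k = n 0} {A : ∀ j : ℕ, Matrix (Fin (n j)) (Fin (n (j + 1))) ℝ}
    (hA : ¬ HasECycle k n hn A) :
    IsP0Matrix ((matProd0 n A k).submatrix id (Fin.cast hn.symm)) := by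
  intro α
  have h := det_mul_prod_nonneg hk hA α k le_rfl
    (fun j i => ⟨(i : Fin (n 0)) % n j, Nat.mod_lt _ (hpos j)⟩)
    (fun i => Fin.ext (Nat.mod_eq_of_lt (i.1.2.trans_eq hn.symm)))
    fun j hj hjk => absurd hj hjk.not_ge
  rw [Ico_self, prod_empty, mul_one] at h
  convert h using 2
  ext i j
  exact congrArg _ (Fin.ext (Nat.mod_eq_of_lt (j.1.2.trans_eq hn.symm)).symm)

open Classical in
/-- A matrix list in the qualitative class of `A`, for `ε > 0`, that keeps the entries
of `A` along `v` and scales the others by `ε`. -/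
noncomputable def cycleScale {T : Type*} {n : ℕ → ℕ}
    (A : ∀ j : ℕ, Matrix (Fin (n j)) (Fin (n (j + 1))) ℝ) (v : ∀ j : ℕ, T → Fin (n j)) (ε : ℝ)
    (j : ℕ) : Matrix (Fin (n j)) (Fin (n (j + 1))) ℝ :=
  fun x y => if ∃ t, v j t = x ∧ v (j + 1) t = y then A j x y else ε * A j x y

theorem inQualClass_cycleScale {T : Type*} {n : ℕ → ℕ}
    (A : ∀ j : ℕ, Matrix (Fin (n j)) (Fin (n (j + 1))) ℝ) (v : ∀ j : ℕ, T → Fin (n j)) {ε : ℝ}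
    (hε : 0 < ε) (j : ℕ) : InQualClass (cycleScale A v ε j) (A j) := by
  intro x y
  unfold cycleScale
  split_ifs
  · simp
  · exact ⟨mul_pos hε, mul_neg_of_pos_of_neg hε, fun h => by rw [h, mul_zero]⟩

theorem continuous_matProd0_cycleScale {T : Type*} {n : ℕ → ℕ}
    (A : ∀ j : ℕ, Matrix (Fin (n j)) (Fin (n (j + 1))) ℝ) (v : ∀ j : ℕ, T → Fin (n j)) (l : ℕ) :
    Continuous fun ε => matProd0 n (cycleScale A v ε) l := by
  induction l with
  | zero => exact continuous_const
  | succ l ih =>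
    refine ih.matrix_mul (continuous_matrix fun x y => ?_)
    unfold cycleScale
    split_ifs <;> fun_prop

theorem matProd0_cycleScale_zero {T : Type*} {k : ℕ} {n : ℕ → ℕ}
    (A : ∀ j : ℕ, Matrix (Fin (n j)) (Fin (n (j + 1))) ℝ) (v : ∀ j : ℕ, T → Fin (n j))
    (hv : ∀ j < k, Function.Injective (v j)) (t : T) (l : ℕ) (hl : l ≤ k) (y : Fin (n l)) :
    matProd0 n (cycleScale A v 0) l (v 0 t) y =
      if y = v l t then ∏ j ∈ range l, A j (v j t) (v (j + 1) t) else 0 := by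
  induction l with
  | zero => simp [matProd0, Matrix.one_apply, eq_comm]
  | succ l ih =>
    simp only [matProd0, Matrix.mul_apply, ih (by omega), ite_mul, zero_mul, sum_ite_eq',
      mem_univ, if_true, prod_range_succ]
    have : (∃ s, v l s = v l t ∧ v (l + 1) s = y) ↔ y = v (l + 1) t :=
      ⟨fun ⟨s, hs, h⟩ => by rw [← h, hv l hl hs], fun h => ⟨t, rfl, h.symm⟩⟩
    unfold cycleScale
    simp only [this]
    split_ifs with h
    · rw [h]
    · simp

theorem det_shift (m : ℕ) (F : ZMod (m + 1) → ℝ) :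
    (Matrix.of fun s t : ZMod (m + 1) => if t = s + 1 then F s else 0).det =
      (-1) ^ m * ∏ t, F t := by
  have h : (Matrix.of fun s t : ZMod (m + 1) => if t = s + 1 then F s else 0) =
      (Matrix.diagonal F).submatrix id (Equiv.addRight (1 : ZMod (m + 1))).symm := by
    ext s t
    simp [Matrix.diagonal_apply, eq_sub_iff_add_eq, ← sub_eq_add_neg, eq_comm]
  have hrot : Perm.sign (Equiv.addRight (1 : ZMod (m + 1))) = Perm.sign (finRotate (m + 1)) :=
    Perm.sign_eq_sign_of_equiv _ _ (ZMod.finEquiv (m + 1)).symm.toEquiv fun t => by simp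
  rw [h, Matrix.det_permute', Matrix.det_diagonal, Perm.sign_symm, hrot, sign_finRotate]
  simp

theorem stmt7 (k : ℕ) (hk : 1 ≤ k) (n : ℕ → ℕ) (hpos : ∀ j, 0 < n j)
    (hn : n k = n 0)
    (A : ∀ j : ℕ, Matrix (Fin (n j)) (Fin (n (j + 1))) ℝ) :
    (∀ B : ∀ j : ℕ, Matrix (Fin (n j)) (Fin (n (j + 1))) ℝ,
        (∀ j < k, InQualClass (B j) (A j)) →
        IsP0Matrix ((matProd0 n B k).submatrix id (Fin.cast hn.symm))) ↔
      ¬ HasECycle k n hn A := by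
  refine ⟨?_, fun hA B hB =>
    isP0Matrix_of_not_hasECycle hk hpos fun h => hA (h.of_inQualClass hB)⟩
  rintro h ⟨m, v, hinj, hclose, -, hcyc⟩
  have hv0 := hinj 0 hk
  let α : Finset (Fin (n 0)) := univ.image (v 0)
  let D : ℝ → ℝ := fun ε => (((matProd0 n (cycleScale A v ε) k).submatrix id
    (Fin.cast hn.symm)).submatrix (fun i : α => (i : Fin (n 0))) fun i : α => (i : Fin (n 0))).det
  have hD : Continuous D :=
    (((continuous_matProd0_cycleScale A v k).matrix_submatrix _ _).matrix_submatrix _ _).matrix_det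
  have hD0 : D 0 < 0 := by
    let e : ZMod (m + 1) ≃ α := Equiv.ofBijective (fun t => ⟨v 0 t, by simp [α]⟩)
      ⟨fun s t hst => hv0 (congrArg Subtype.val hst), fun ⟨x, hx⟩ => by
        obtain ⟨t, -, rfl⟩ := mem_image.1 hx
        exact ⟨t, rfl⟩⟩
    have hdet : D 0 = (-1) ^ m * ∏ t, ∏ j ∈ range k, A j (v j t) (v (j + 1) t) := by
      refine (Matrix.det_submatrix_equiv_self e _).symm.trans ?_
      rw [← det_shift]
      congr 1
      ext s t
      change matProd0 n (cycleScale A v 0) k (v 0 s) (Fin.cast hn.symm (v 0 t)) = _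
      rw [matProd0_cycleScale_zero A v hinj s k le_rfl, hclose, Matrix.of_apply]
      simp [hv0.eq_iff]
    rw [hdet]
    rw [pow_succ, mul_neg_one, neg_mul] at hcyc
    exact neg_pos.1 hcyc
  obtain ⟨ε, hε, hεpos⟩ := ((hD.continuousAt.eventually (gt_mem_nhds hD0)).filter_mono
    nhdsWithin_le_nhds |>.and (self_mem_nhdsWithin (s := Set.Ioi 0))).exists
  exact hε.not_ge (h _ (fun j _ => inQualClass_cycleScale A v hεpos j) α)
end

section
/- Let A be an n×n real matrix. Then every matrix in the qualitative class Q(A) is a P0-matrix if and only if the signed digraph G_A is e-cycle-free. -/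
open Equiv Equiv.Perm in
/-- The signed contribution of a cyclic permutation is nonnegative when no cycle is an e-cycle. -/
theorem sign_mul_prod_support_nonneg_of_isCycle {ι : Type*} [Fintype ι] [DecidableEq ι]
    (M : Matrix ι ι ℝ)
    (hM : ∀ (m : ℕ) (v : ZMod (m + 1) → ι), Function.Injective v →
      (-1 : ℝ) ^ (m + 1) * ∏ t, M (v t) (v (t + 1)) ≤ 0)
    (σ : Perm ι) (hσ : σ.IsCycle) :
    0 ≤ ((sign σ : ℤ) : ℝ) * ∏ i ∈ σ.support, M i (σ i) := by
  obtain ⟨m, hm⟩ : ∃ m, orderOf σ = m + 1 :=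
    Nat.exists_eq_succ_of_ne_zero (orderOf_pos σ).ne'
  have hcard : σ.support.card = m + 1 := by rw [← hσ.orderOf, hm]
  obtain ⟨x, hx, hx'⟩ := id hσ
  set v : ZMod (m + 1) → ι := fun t => (σ ^ t.val) x with hv
  have hsucc : ∀ t, v (t + 1) = σ (v t) := by
    intro t
    have h : σ ^ (t + 1).val = σ ^ (t.val + 1) := by
      rw [ZMod.val_add, ← pow_mod_orderOf σ (t.val + 1), hm, ZMod.val_one_eq_one_mod,
        Nat.add_mod_mod]
    simp only [hv, h, pow_succ', Perm.mul_apply]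
  have hsupp : ∀ t, v t ∈ σ.support := fun t =>
    pow_apply_mem_support.2 (mem_support.2 hx)
  have himage : Finset.univ.image v = σ.support := by
    apply Finset.Subset.antisymm
    · intro y hy
      obtain ⟨t, -, rfl⟩ := Finset.mem_image.1 hy
      exact hsupp t
    · intro y hy
      obtain ⟨k, hk, rfl⟩ := (hx' (mem_support.1 hy)).exists_pow_eq'
      refine Finset.mem_image.2 ⟨(k : ZMod (m + 1)), Finset.mem_univ _, ?_⟩
      simp only [hv, ZMod.val_natCast]
      rw [← hm, pow_mod_orderOf]
  have hinj : Function.Injective v := by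
    rw [← Finset.card_image_iff.trans (by simp [Set.injOn_univ] :
      Set.InjOn v (Finset.univ : Finset (ZMod (m + 1))) ↔ Function.Injective v)]
    rw [himage, hcard, Finset.card_univ, ZMod.card]
  have h := hM m v hinj
  have hprod : ∏ i ∈ σ.support, M i (σ i) = ∏ t, M (v t) (v (t + 1)) := by
    rw [← himage, Finset.prod_image hinj.injOn]
    simp only [hsucc]
  rw [hprod, hσ.sign, hcard]
  push_cast
  linarith

open Equiv Equiv.Perm in
/-- A real matrix without e-cycles has nonnegative determinant. -/
theorem det_nonneg_of_no_eCycle {ι : Type*} [Fintype ι] [DecidableEq ι]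
    (M : Matrix ι ι ℝ)
    (hM : ∀ (m : ℕ) (v : ZMod (m + 1) → ι), Function.Injective v →
      (-1 : ℝ) ^ (m + 1) * ∏ t, M (v t) (v (t + 1)) ≤ 0) :
    0 ≤ M.det := by
  have key : ∀ σ : Perm ι, 0 ≤ ((sign σ : ℤ) : ℝ) * ∏ i ∈ σ.support, M i (σ i) := by
    intro σ
    induction σ using cycle_induction_on with
    | base_one => simp
    | base_cycles σ hσ => exact sign_mul_prod_support_nonneg_of_isCycle M hM σ hσ
    | induction_disjoint σ τ hd _ h₁ h₂ =>
      have hσ : ∏ i ∈ σ.support, M i ((σ * τ) i) = ∏ i ∈ σ.support, M i (σ i) := by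
        refine Finset.prod_congr rfl fun i hi => ?_
        rw [Perm.mul_apply, (hd i).resolve_left (mem_support.1 hi)]
      have hτ : ∏ i ∈ τ.support, M i ((σ * τ) i) = ∏ i ∈ τ.support, M i (τ i) := by
        refine Finset.prod_congr rfl fun i hi => ?_
        rw [hd.commute.eq, Perm.mul_apply, (hd i).resolve_right (mem_support.1 hi)]
      rw [hd.support_mul, Finset.prod_union hd.disjoint_support, hσ, hτ, Perm.sign_mul]
      push_cast
      calc (0 : ℝ) ≤ _ := mul_nonneg h₁ h₂
        _ = _ := by ring
  have hdiag : ∀ i, 0 ≤ M i i := by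
    intro i
    have h := hM 0 (fun _ => i) (fun a b _ => Subsingleton.elim (α := Fin 1) a b)
    simpa using h
  rw [← Matrix.det_transpose, Matrix.det_apply']
  refine Finset.sum_nonneg fun σ _ => ?_
  simp only [Matrix.transpose_apply]
  rw [← Finset.prod_mul_prod_compl σ.support, ← mul_assoc]
  refine mul_nonneg (key σ) (Finset.prod_nonneg fun i hi => ?_)
  rw [notMem_support.1 (Finset.mem_compl.1 hi)]
  exact hdiag i

/-- The determinant of the weighted adjacency matrix of a directed cycle. -/
theorem det_weighted_cycle (m : ℕ) (d : ZMod (m + 1) → ℝ) :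
    (Matrix.of fun s t : ZMod (m + 1) => if t = s + 1 then d s else 0).det =
      (-1) ^ m * ∏ t, d t := by
  let σ : Equiv.Perm (ZMod (m + 1)) := finRotate (m + 1)
  have hσ : ∀ t, σ t = t + 1 := fun t => finRotate_apply (n := m + 1) t
  have hsign : Equiv.Perm.sign σ = (-1) ^ m := sign_finRotate (m + 1)
  have h : (Matrix.of fun s t : ZMod (m + 1) => if t = s + 1 then d s else 0) =
      (Matrix.diagonal d).submatrix id (σ⁻¹ : Equiv.Perm _) := by
    ext s t
    have : s = σ⁻¹ t ↔ t = s + 1 := by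
      rw [Equiv.Perm.eq_inv_iff_eq, hσ, eq_comm]
    simp only [Matrix.of_apply, Matrix.submatrix_apply, Matrix.diagonal_apply, id, this]
  rw [h, Matrix.det_permute', Equiv.Perm.sign_inv, hsign, Matrix.det_diagonal]
  push_cast
  rfl

/-- A matrix in the qualitative class of `A` is an entrywise positive rescaling of `A`. -/
theorem InQualClass.exists_pos_mul {p q : ℕ} {X A : Matrix (Fin p) (Fin q) ℝ}
    (h : InQualClass X A) (i : Fin p) (j : Fin q) : ∃ c : ℝ, 0 < c ∧ X i j = c * A i j := by
  obtain ⟨h₁, h₂, h₃⟩ := h i j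
  rcases lt_trichotomy (A i j) 0 with hA | hA | hA
  · exact ⟨X i j / A i j, div_pos_of_neg_of_neg (h₂ hA) hA, (div_mul_cancel₀ _ hA.ne).symm⟩
  · exact ⟨1, one_pos, by simp [h₃ hA, hA]⟩
  · exact ⟨X i j / A i j, div_pos (h₁ hA) hA, (div_mul_cancel₀ _ hA.ne').symm⟩

/-- An e-cycle makes some matrix of the qualitative class fail to be a P0-matrix. -/
theorem HasECycleSq.exists_not_isP0Matrix {n : ℕ} {A : Matrix (Fin n) (Fin n) ℝ}
    (h : HasECycleSq A) : ∃ X, InQualClass X A ∧ ¬ IsP0Matrix X := by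
  classical
  obtain ⟨m, v, hv, -, hpos⟩ := h
  let X : ℝ → Matrix (Fin n) (Fin n) ℝ := fun ε => Matrix.of fun i j =>
    if ∃ t, i = v t ∧ j = v (t + 1) then A i j else ε * A i j
  have hcont : Continuous fun ε => ((X ε).submatrix v v).det := by
    refine Continuous.matrix_det (continuous_matrix fun s t => ?_)
    simp only [X, Matrix.submatrix_apply, Matrix.of_apply]
    split_ifs <;> fun_prop
  have hzero : ((X 0).submatrix v v).det < 0 := by
    have : (X 0).submatrix v v =
        Matrix.of fun s t => if t = s + 1 then A (v s) (v (s + 1)) else 0 := by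
      ext s t
      have hiff : (∃ r, v s = v r ∧ v t = v (r + 1)) ↔ t = s + 1 := by
        constructor
        · rintro ⟨r, hr, hr'⟩
          rw [hv hr, hv hr']
        · rintro rfl
          exact ⟨s, rfl, rfl⟩
      simp only [X, Matrix.submatrix_apply, Matrix.of_apply, hiff, zero_mul]
      split_ifs with hst
      · rw [hst]
      · rfl
    rw [this, det_weighted_cycle]
    rw [pow_succ] at hpos
    linarith
  obtain ⟨ε, hneg, hε⟩ :=
    (((hcont.tendsto 0).eventually (gt_mem_nhds hzero)).filter_mono
      nhdsWithin_le_nhds |>.and (self_mem_nhdsWithin (s := Set.Ioi (0 : ℝ)))).exists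
  have hε : 0 < ε := hε
  refine ⟨X ε, fun i j => ?_, fun hP => ?_⟩
  · simp only [X, Matrix.of_apply]
    split_ifs
    · exact ⟨id, id, id⟩
    · exact ⟨fun h => mul_pos hε h, fun h => mul_neg_of_pos_of_neg hε h, fun h => by simp [h]⟩
  · let e : ZMod (m + 1) ≃ {x // x ∈ Finset.univ.image v} :=
      (Equiv.ofInjective v hv).trans (Equiv.subtypeEquivRight (by simp))
    have h := hP (Finset.univ.image v)
    rw [← Matrix.det_submatrix_equiv_self e, Matrix.submatrix_submatrix] at h
    exact absurd h (not_le.2 hneg)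

theorem stmt8 {n : ℕ} (A : Matrix (Fin n) (Fin n) ℝ) :
    (∀ X : Matrix (Fin n) (Fin n) ℝ, InQualClass X A → IsP0Matrix X) ↔
      ¬ HasECycleSq A := by
  constructor
  · intro h hA
    obtain ⟨X, hX, hP⟩ := hA.exists_not_isP0Matrix
    exact hP (h X hX)
  · intro hA X hX α
    refine det_nonneg_of_no_eCycle _ fun m v hv => ?_
    by_contra! hpos
    choose c hc hXc using hX.exists_pos_mul
    simp only [Matrix.submatrix_apply, hXc, Finset.prod_mul_distrib] at hpos
    rw [mul_left_comm] at hpos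
    have hpos' := pos_of_mul_pos_right hpos (Finset.prod_nonneg fun t _ => (hc _ _).le)
    refine hA ⟨m, fun t => v t, Subtype.val_injective.comp hv, fun t ht => ?_, hpos'⟩
    rw [Finset.prod_eq_zero (Finset.mem_univ t) ht, mul_zero] at hpos'
    exact lt_irrefl _ hpos'
end
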